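/- arXiv:1405.3955 — 2 statements merged into one kernel-verified Lean document; each statement's English description precedes it below -/
import Mathlib

section
/- (Lemma 1, saturated p-function equals the selection set.) In the saturation setup, for every d : D the following hold: (1) if f d ≠ none then F d = Sel d, i.e. the union-of-graphs p-function of the saturated family returns exactly the set of tuples of B that agree with the prescribed tuple τ d on all variable coordinates in Z; (2) if f d = none (the original function returns the empty tuple on d) then F d = ∅. -/
/-- The selection set `Sel d`: the tuples of the target relation `B` that
agree with the prescribed tuple `τ d` on all variable coordinates in `Z`
(the result of `SELECT (*) FROM ‖r_B‖ WHERE …`). -/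
def selSet {D γ : Type*} {n : ℕ} (B : Set (Fin n → γ)) (Z : Set (Fin n))
    (τ : D → Fin n → γ) (d : D) : Set (Fin n → γ) :=
  {b ∈ B | ∀ j ∈ Z, b j = τ d j}

/-- The saturated family `Sat f`: the original partial tuple-function `f`
together with, for each input `d₀` on which `f` is defined and each tuple
`b` of the selection set at `d₀`, the function differing from `f` only at
`d₀`, where it returns `b`. -/
def satFamily {D γ : Type*} [DecidableEq D] {n : ℕ} (B : Set (Fin n → γ))
    (Z : Set (Fin n)) (τ : D → Fin n → γ) (f : D → Option (Fin n → γ)) :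
    Set (D → Option (Fin n → γ)) :=
  {f} ∪ {g | ∃ d₀ : D, f d₀ ≠ none ∧
    ∃ b ∈ selSet B Z τ d₀, g = Function.update f d₀ (some b)}

/-- Lemma 1: the union-of-graphs p-function `F` of the saturated family
returns exactly the selection set on inputs where `f` is defined, and the
empty set on inputs where `f` returns the empty tuple. -/
theorem saturated_pfunction_eq_selection {D γ : Type*} [DecidableEq D] {n : ℕ}
    (B : Set (Fin n → γ)) (Z : Set (Fin n)) (τ : D → Fin n → γ)
    (f : D → Option (Fin n → γ))
    (hcompat : ∀ d b, f d = some b → b = τ d ∧ τ d ∈ B)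
    (F : D → Set (Fin n → γ))
    (hF : ∀ d, F d = {b | ∃ h ∈ satFamily B Z τ f, h d = some b}) :
    ∀ d : D, (f d ≠ none → F d = selSet B Z τ d) ∧ (f d = none → F d = ∅) := by
  intro d
  rw [hF]
  constructor
  · intro hd
    ext b
    constructor
    · have mem_of_eq (hb : f d = some b) : b ∈ selSet B Z τ d := by
        obtain ⟨rfl, hB⟩ := hcompat d b hb
        exact ⟨hB, fun _ _ => rfl⟩
      rintro ⟨h, rfl | ⟨d₀, -, b₀, hb₀, rfl⟩, hb⟩
      · exact mem_of_eq hb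
      · obtain rfl | hne := eq_or_ne d d₀
        · rw [Function.update_self, Option.some_inj] at hb
          exact hb ▸ hb₀
        · rw [Function.update_of_ne hne] at hb
          exact mem_of_eq hb
    · intro hb
      exact ⟨_, Or.inr ⟨d, hd, b, hb, rfl⟩, Function.update_self ..⟩
  · intro hd
    refine Set.eq_empty_of_forall_notMem ?_
    rintro b ⟨h, rfl | ⟨d₀, hd₀, b₀, -, rfl⟩, hb⟩
    · simp [hd] at hb
    · have hne : d ≠ d₀ := fun e => hd₀ (e ▸ hd)
      simp [Function.update_of_ne hne, hd] at hb
end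

section
/- (Corollary 1, invariance of the information-flux kernel under saturation.) In the saturation setup, let π_Z : (Fin n → γ) → (Z → γ) denote the restriction of a tuple to the coordinates in Z. Then the union over all functions of the saturated family of the Z-projections of their images equals the Z-projection of the image of the original function: ⋃_{h ∈ Sat f} {π_Z b | ∃ d : D, h d = some b} = {π_Z b | ∃ d : D, f d = some b}. Consequently the kernel of the information flux, which is built from the projections of the images of the mapping functions onto the free-variable coordinates, is unchanged by saturation, so the saturated morphism and the original morphism have the same information flux. -/
/-- Restriction of a tuple to the coordinates in `Z`. -/
def projZ {γ : Type*} {n : ℕ} (Z : Set (Fin n)) (b : Fin n → γ) : Z → γ :=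
  fun j => b j

/-- Corollary 1 (invariance of the information-flux kernel under
saturation): the union, over all functions of the saturated family, of the
`Z`-projections of their images equals the `Z`-projection of the image of
the original function; hence saturation does not change the information
flux of the morphism. -/
theorem satFamily_flux_invariant {D γ : Type*} [DecidableEq D] {n : ℕ}
    (B : Set (Fin n → γ)) (Z : Set (Fin n)) (τ : D → Fin n → γ)
    (f : D → Option (Fin n → γ))
    (hcompat : ∀ d b, f d = some b → b = τ d ∧ τ d ∈ B) :
    (⋃ h ∈ satFamily B Z τ f,
        {p : Z → γ | ∃ b : Fin n → γ, (∃ d : D, h d = some b) ∧ p = projZ Z b})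
      = {p : Z → γ | ∃ b : Fin n → γ, (∃ d : D, f d = some b) ∧ p = projZ Z b} := by
  ext p
  simp only [Set.mem_iUnion, Set.mem_ofPred_eq, exists_prop]
  constructor
  · rintro ⟨h, rfl | ⟨d₀, hd₀, c, hc, rfl⟩, b, ⟨d, hd⟩, rfl⟩
    · exact ⟨b, ⟨d, hd⟩, rfl⟩
    · by_cases hdd : d = d₀
      · subst hdd
        obtain rfl : c = b := by simpa using hd
        obtain ⟨a, ha⟩ := Option.ne_none_iff_exists'.mp hd₀
        refine ⟨a, ⟨d, ha⟩, funext fun j => ?_⟩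
        rw [(hcompat d a ha).1]
        exact hc.2 j j.2
      · rw [Function.update_of_ne hdd] at hd
        exact ⟨b, ⟨d, hd⟩, rfl⟩
  · exact fun hp => ⟨f, Or.inl rfl, hp⟩
end
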